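/- Let p ≥ 1, B⁺ = {b ∈ ℝ^p : b₁ ≥ … ≥ b_p ≥ 1}, and λ ∈ ℝ^p with λ ≺ 0. Let φ : B⁺ → ℝ be measurable and weakly bounded by b^{λ} = ∏_{i=1}^{p} b_i^{λ_i}. Set μ = max{ η₁ + … + η_p : η ∈ [0,1]^p, λ + η ⪯ 0 } (the maximum exists since the constraint set is a nonempty compact subset of ℝ^p). Then for every a ≥ 1 the integral L(a,φ) = ∫_{B⁺} (∏_{i=1}^{p} (a² + b_i²)^{-1/2}) φ(b) db converges absolutely, and as a function of a ∈ [1,∞) it is weakly bounded by a^{-μ}: for every δ ∈ (0,1) there is C > 0 with |L(a,φ)| ≤ C a^{-μ(1-δ)} for all a ≥ 1. -/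

import Mathlib

open MeasureTheory Set Finset

/-- The region `B⁺ = {b ∈ ℝ^p : b₁ ≥ b₂ ≥ … ≥ b_p ≥ 1}`. -/
def Bplus (p : ℕ) : Set (Fin p → ℝ) :=
  {b | (∀ i, 1 ≤ b i) ∧ ∀ i j : Fin p, i ≤ j → b j ≤ b i}

/-- Abel summation: nonpositive partial sums paired with a nonnegative antitone sequence. -/
theorem sum_mul_nonpos_of_antitone {p : ℕ} (x y : Fin p → ℝ)
    (hx : ∀ j : Fin p, ∑ i ∈ Finset.Iic j, x i ≤ 0) (hy : ∀ i, 0 ≤ y i) (hanti : Antitone y) :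
    ∑ i, x i * y i ≤ 0 := by
  induction p with
  | zero => simp
  | succ n ih =>
    have hpart : ∀ j : Fin n, ∑ i ∈ Finset.Iic j, x i.castSucc ≤ 0 := fun j ↦ by
      simpa [← Fin.map_castSuccEmb_Iic] using hx j.castSucc
    have hdiff := ih (fun i ↦ x i.castSucc) (fun i ↦ y i.castSucc - y (Fin.last n)) hpart
      (fun i ↦ sub_nonneg.2 (hanti (Fin.le_last _)))
      (fun i j hij ↦ sub_le_sub_right (hanti (Fin.castSucc_le_castSucc_iff.2 hij)) _)
    have htot : ∑ i, x i ≤ 0 := by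
      have h := hx (Fin.last n)
      rwa [← Fin.top_eq_last, Finset.Iic_top] at h
    have hlast := mul_nonpos_of_nonpos_of_nonneg htot (hy (Fin.last n))
    rw [Fin.sum_univ_castSucc] at hlast ⊢
    simp only [mul_sub, Finset.sum_sub_distrib, ← Finset.sum_mul] at hdiff
    linarith

theorem prod_rpow_le_one_of_mem_Bplus {p : ℕ} (x b : Fin p → ℝ)
    (hx : ∀ j : Fin p, ∑ i ∈ Finset.Iic j, x i ≤ 0) (hb : b ∈ Bplus p) :
    ∏ i, b i ^ x i ≤ 1 := by
  have hpos : ∀ i, 0 < b i := fun i ↦ zero_lt_one.trans_le (hb.1 i)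
  have hexp : ∏ i, b i ^ x i = Real.exp (∑ i, x i * Real.log (b i)) := by
    rw [Real.exp_sum]
    refine Finset.prod_congr rfl fun i _ ↦ ?_
    rw [Real.rpow_def_of_pos (hpos i), mul_comm]
  rw [hexp, Real.exp_le_one_iff]
  exact sum_mul_nonpos_of_antitone x _ hx (fun i ↦ Real.log_nonneg (hb.1 i))
    fun i j hij ↦ Real.log_le_log (hpos j) (hb.2 i j hij)

theorem measurableSet_Bplus (p : ℕ) : MeasurableSet (Bplus p) := by
  refine IsClosed.measurableSet ?_
  simp only [Bplus, Set.ofPred_and, Set.ofPred_forall]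
  refine IsClosed.inter (isClosed_iInter fun i ↦ isClosed_le continuous_const
    (continuous_apply i)) ?_
  exact isClosed_iInter fun i ↦ isClosed_iInter fun j ↦ isClosed_iInter fun _ ↦
    isClosed_le (continuous_apply j) (continuous_apply i)

theorem integrableOn_prod_rpow_Bplus (p : ℕ) {ε : ℝ} (hε : 0 < ε) :
    IntegrableOn (fun b : Fin p → ℝ ↦ ∏ i, b i ^ (-1 - ε)) (Bplus p) := by
  have hpi : IntegrableOn (fun b : Fin p → ℝ ↦ ∏ i, b i ^ (-1 - ε))
      (Set.univ.pi fun _ ↦ Set.Ici 1) := by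
    rw [IntegrableOn, volume_pi, Measure.restrict_pi_pi]
    refine Integrable.fintype_prod (f := fun _ x ↦ x ^ (-1 - ε)) fun _ ↦ ?_
    exact (integrableOn_Ici_iff_integrableOn_Ioi (by simp)).2
      (integrableOn_Ioi_rpow_of_lt (by linarith) one_pos)
  exact hpi.mono_set fun b hb i _ ↦ hb.1 i

theorem exists_pos_forall_add_mul_nonpos {p : ℕ} (s t : Fin p → ℝ) (hs : ∀ j, s j < 0) :
    ∃ ε > 0, ∀ j, s j + ε * t j ≤ 0 := by
  have hev : ∀ j, ∀ᶠ ε in nhdsWithin (0 : ℝ) (Set.Ioi 0), s j + ε * t j ≤ 0 := fun j ↦ by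
    have hcont : Continuous fun ε : ℝ ↦ s j + ε * t j := by fun_prop
    have := (hcont.tendsto 0).eventually_le_const (u := 0) (by simpa using hs j)
    exact this.filter_mono nhdsWithin_le_nhds
  obtain ⟨ε, h, hε⟩ := ((Filter.eventually_all.2 hev).and self_mem_nhdsWithin).exists
  exact ⟨ε, hε, h⟩

theorem sq_add_sq_rpow_le {a b θ : ℝ} (ha : 0 < a) (hb : 0 < b) (h0 : 0 ≤ θ) (h1 : θ ≤ 1) :
    (a ^ 2 + b ^ 2) ^ (-(1 : ℝ) / 2) ≤ a ^ (-θ) * b ^ (-1 + θ) := by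
  have hle : ∀ {c s : ℝ}, 0 < c → c ^ 2 ≤ s → s ^ (-(1 : ℝ) / 2) ≤ c ^ (-1 : ℝ) := by
    intro c s hc hcs
    calc s ^ (-(1 : ℝ) / 2) ≤ (c ^ 2) ^ (-(1 : ℝ) / 2) :=
          Real.rpow_le_rpow_of_nonpos (by positivity) hcs (by norm_num)
      _ = c ^ (-1 : ℝ) := by
          rw [← Real.rpow_natCast, ← Real.rpow_mul hc.le]; norm_num
  have hx : 0 < (a ^ 2 + b ^ 2) ^ (-(1 : ℝ) / 2) := by positivity
  calc (a ^ 2 + b ^ 2) ^ (-(1 : ℝ) / 2)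
      = ((a ^ 2 + b ^ 2) ^ (-(1 : ℝ) / 2)) ^ θ *
          ((a ^ 2 + b ^ 2) ^ (-(1 : ℝ) / 2)) ^ (1 - θ) := by
        rw [← Real.rpow_add hx]; simp
    _ ≤ (a ^ (-1 : ℝ)) ^ θ * (b ^ (-1 : ℝ)) ^ (1 - θ) := by
        gcongr
        · exact hle ha (by nlinarith)
        · exact hle hb (by nlinarith)
    _ = a ^ (-θ) * b ^ (-1 + θ) := by
        rw [← Real.rpow_mul ha.le, ← Real.rpow_mul hb.le]; ring_nf

/-- A feasible `η` gives a dominating function for the integrand, uniformly in `a`. -/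
theorem exists_integrable_dominating {p : ℕ} (lam : Fin p → ℝ)
    (hlam : ∀ j : Fin p, ∑ i ∈ Finset.Iic j, lam i < 0)
    (φ : (Fin p → ℝ) → ℝ)
    (hwb : ∃ δ₀ > (0 : ℝ), ∀ δ : ℝ, 0 < δ → δ < δ₀ →
      ∃ C > (0 : ℝ), ∀ b ∈ Bplus p, |φ b| ≤ C * ∏ i, b i ^ (lam i * (1 - δ)))
    (η : Fin p → ℝ) (hη : ∀ i, η i ∈ Set.Icc (0 : ℝ) 1)
    (hfeas : ∀ j : Fin p, ∑ i ∈ Finset.Iic j, (lam i + η i) ≤ 0)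
    {δ : ℝ} (hδ0 : 0 < δ) (hδ1 : δ < 1) :
    ∃ g : (Fin p → ℝ) → ℝ, IntegrableOn g (Bplus p) ∧
      ∀ a : ℝ, 1 ≤ a → ∀ b ∈ Bplus p,
        |(∏ i, (a ^ 2 + b i ^ 2) ^ (-(1 : ℝ) / 2)) * φ b| ≤
          a ^ (-((∑ i, η i) * (1 - δ))) * g b := by
  obtain ⟨δ₀, hδ₀, hwb⟩ := hwb
  obtain ⟨δ', hδ', hδ'lt⟩ := exists_between (lt_min hδ₀ hδ0)
  obtain ⟨C, hC, hφ⟩ := hwb δ' hδ' (hδ'lt.trans_le (min_le_left _ _))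
  have hδδ' : δ' < δ := hδ'lt.trans_le (min_le_right _ _)
  have hneg : ∀ j : Fin p, ∑ i ∈ Finset.Iic j, (η i * (1 - δ) + lam i * (1 - δ')) < 0 := by
    intro j
    have h := hfeas j
    rw [Finset.sum_add_distrib] at h
    rw [Finset.sum_add_distrib, ← Finset.sum_mul, ← Finset.sum_mul]
    nlinarith [hlam j]
  obtain ⟨ε, hε, hεle⟩ := exists_pos_forall_add_mul_nonpos _
    (fun j ↦ ∑ _i ∈ Finset.Iic j, (1 : ℝ)) hneg
  refine ⟨fun b ↦ C * ∏ i, b i ^ (-1 - ε), (integrableOn_prod_rpow_Bplus p hε).const_mul C,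
    fun a ha b hb ↦ ?_⟩
  have ha0 : 0 < a := zero_lt_one.trans_le ha
  have hpos : ∀ i, 0 < b i := fun i ↦ zero_lt_one.trans_le (hb.1 i)
  have hker : ∏ i, (a ^ 2 + b i ^ 2) ^ (-(1 : ℝ) / 2) ≤
      a ^ (-((∑ i, η i) * (1 - δ))) * ∏ i, b i ^ (-1 + η i * (1 - δ)) := by
    calc ∏ i, (a ^ 2 + b i ^ 2) ^ (-(1 : ℝ) / 2)
        ≤ ∏ i, (a ^ (-(η i * (1 - δ))) * b i ^ (-1 + η i * (1 - δ))) := by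
          refine Finset.prod_le_prod (fun i _ ↦ by positivity) fun i _ ↦ ?_
          exact sq_add_sq_rpow_le ha0 (hpos i) (mul_nonneg (hη i).1 (by linarith))
            (mul_le_one₀ (hη i).2 (by linarith) (by linarith))
      _ = _ := by
          rw [Finset.prod_mul_distrib, ← Real.rpow_sum_of_pos ha0, Finset.sum_neg_distrib,
            Finset.sum_mul]
  have hone : ∏ i, b i ^ (η i * (1 - δ) + lam i * (1 - δ') + ε) ≤ 1 := by
    refine prod_rpow_le_one_of_mem_Bplus _ b (fun j ↦ ?_) hb
    rw [Finset.sum_add_distrib]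
    simpa [mul_comm] using hεle j
  have hnonneg : ∀ f : Fin p → ℝ, 0 ≤ ∏ i, b i ^ f i := fun f ↦
    Finset.prod_nonneg fun i _ ↦ Real.rpow_nonneg (hpos i).le _
  rw [abs_mul, abs_of_nonneg (Finset.prod_nonneg fun i _ ↦ by positivity)]
  calc _ ≤ (a ^ (-((∑ i, η i) * (1 - δ))) * ∏ i, b i ^ (-1 + η i * (1 - δ))) *
        (C * ∏ i, b i ^ (lam i * (1 - δ'))) :=
        mul_le_mul hker (hφ b hb) (abs_nonneg _)
          (mul_nonneg (Real.rpow_nonneg ha0.le _) (hnonneg _))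
    _ = a ^ (-((∑ i, η i) * (1 - δ))) * (C * ((∏ i, b i ^ (-1 - ε)) *
        ∏ i, b i ^ (η i * (1 - δ) + lam i * (1 - δ') + ε))) := by
        have hsplit : (∏ i, b i ^ (-1 + η i * (1 - δ))) * ∏ i, b i ^ (lam i * (1 - δ')) =
            (∏ i, b i ^ (-1 - ε)) * ∏ i, b i ^ (η i * (1 - δ) + lam i * (1 - δ') + ε) := by
          rw [← Finset.prod_mul_distrib, ← Finset.prod_mul_distrib]
          refine Finset.prod_congr rfl fun i _ ↦ ?_
          rw [← Real.rpow_add (hpos i), ← Real.rpow_add (hpos i)]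
          ring_nf
        rw [← hsplit]
        ring
    _ ≤ a ^ (-((∑ i, η i) * (1 - δ))) * (C * ∏ i, b i ^ (-1 - ε)) := by
        gcongr
        exact mul_le_of_le_one_right (hnonneg _) hone

/-- Let `p ≥ 1`, `λ ≺ 0`, and `φ : B⁺ → ℝ` measurable and weakly bounded by
`∏ᵢ bᵢ^{λᵢ}`. Let `μ = max{η₁+…+η_p : η ∈ [0,1]^p, λ + η ⪯ 0}`. Then for every
`a ≥ 1` the integral `L(a,φ) = ∫_{B⁺} (∏ᵢ (a²+bᵢ²)^{-1/2}) φ(b) db` converges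
absolutely, and it is weakly bounded by `a^{-μ}`: for every `δ ∈ (0,1)` there is
`C > 0` with `|L(a,φ)| ≤ C a^{-μ(1-δ)}` for all `a ≥ 1`. -/
theorem stmt_8 (p : ℕ) (hp : 1 ≤ p) (lam : Fin p → ℝ)
    (hlam : ∀ j : Fin p, ∑ i ∈ Finset.Iic j, lam i < 0)
    (φ : (Fin p → ℝ) → ℝ) (hφmeas : Measurable φ)
    (hwb : ∃ δ₀ > (0 : ℝ), ∀ δ : ℝ, 0 < δ → δ < δ₀ →
      ∃ C > (0 : ℝ), ∀ b ∈ Bplus p, |φ b| ≤ C * ∏ i, b i ^ (lam i * (1 - δ)))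
    (μ : ℝ)
    (hμ : IsGreatest
      {s : ℝ | ∃ η : Fin p → ℝ, (∀ i, η i ∈ Set.Icc (0 : ℝ) 1) ∧
        (∀ j : Fin p, ∑ i ∈ Finset.Iic j, (lam i + η i) ≤ 0) ∧ s = ∑ i, η i} μ) :
    (∀ a : ℝ, 1 ≤ a →
      IntegrableOn
        (fun b : Fin p → ℝ => (∏ i, (a ^ 2 + b i ^ 2) ^ (-(1 : ℝ) / 2)) * φ b)
        (Bplus p)) ∧
    (∀ δ : ℝ, 0 < δ → δ < 1 → ∃ C > (0 : ℝ), ∀ a : ℝ, 1 ≤ a →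
      |∫ b in Bplus p, (∏ i, (a ^ 2 + b i ^ 2) ^ (-(1 : ℝ) / 2)) * φ b| ≤
        C * a ^ (-(μ * (1 - δ)))) := by
  obtain ⟨η, hη, hfeas, rfl⟩ := hμ.1
  have hdom := fun {δ : ℝ} ↦
    exists_integrable_dominating lam hlam φ hwb η hη hfeas (δ := δ)
  refine ⟨fun a ha ↦ ?_, fun δ hδ0 hδ1 ↦ ?_⟩
  · obtain ⟨g, hg, hle⟩ := hdom (δ := 1 / 2) (by norm_num) (by norm_num)
    refine Integrable.mono' (hg.const_mul (a ^ (-((∑ i, η i) * (1 - 1 / 2)))))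
      (Measurable.aestronglyMeasurable (by fun_prop)) ?_
    exact ae_restrict_of_forall_mem (measurableSet_Bplus p) (hle a ha)
  · obtain ⟨g, hg, hle⟩ := hdom hδ0 hδ1
    refine ⟨max 1 (∫ b in Bplus p, g b), by positivity, fun a ha ↦ ?_⟩
    have hnorm := norm_integral_le_of_norm_le
      (f := fun b ↦ (∏ i, (a ^ 2 + b i ^ 2) ^ (-(1 : ℝ) / 2)) * φ b)
      (hg.const_mul (a ^ (-((∑ i, η i) * (1 - δ)))))
      (ae_restrict_of_forall_mem (measurableSet_Bplus p) (hle a ha))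
    rw [integral_const_mul, mul_comm] at hnorm
    exact hnorm.trans (mul_le_mul_of_nonneg_right (le_max_right _ _)
      (Real.rpow_nonneg (by linarith) _))
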